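/- For all real numbers x, y and every natural number n, the Golden binomial expansion holds: ∏_{k=0}^{n−1} (x + (−1)^k·φ^{n−1−2k}·y) = ∑_{k=0}^{n} (F_n!/(F_k!·F_{n−k}!))·(−1)^{k(k−1)/2}·x^{n−k}·y^k, where powers of φ with negative exponents are integer powers of the nonzero real φ. -/

import Mathlib

noncomputable def φ : ℝ := (1 + Real.sqrt 5) / 2

/-- The Fibonacci factorial `F_n! = F_1 ⋯ F_n`. -/
noncomputable def fibFact (n : ℕ) : ℝ := ∏ i ∈ Finset.range n, (Nat.fib (i + 1) : ℝ)

theorem φ_eq_goldenRatio : φ = Real.goldenRatio := rfl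

theorem fib_add_eq_goldenRatio_pow_mul_fib (a b : ℕ) :
    (Nat.fib (a + b) : ℝ) =
      Real.goldenRatio ^ a * Nat.fib b + Real.goldenConj ^ b * Nat.fib a := by
  simp only [Real.coe_fib_eq]
  ring

theorem fibFact_succ (n : ℕ) : fibFact (n + 1) = fibFact n * Nat.fib (n + 1) :=
  Finset.prod_range_succ _ _

theorem fibFact_ne_zero (n : ℕ) : fibFact n ≠ 0 :=
  Finset.prod_ne_zero_iff.2 fun i _ => Nat.cast_ne_zero.2 (Nat.fib_pos.2 i.succ_pos).ne'

/-- The analogue of Pascal's rule for Fibonomial coefficients. -/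
theorem fibonomial_succ_succ (k j : ℕ) :
    fibFact (k + j + 2) / (fibFact (k + 1) * fibFact (j + 1)) =
      Real.goldenRatio ^ (k + 1) * (fibFact (k + j + 1) / (fibFact (k + 1) * fibFact j)) +
        Real.goldenConj ^ (j + 1) * (fibFact (k + j + 1) / (fibFact k * fibFact (j + 1))) := by
  have hk := fibFact_ne_zero k
  have hj := fibFact_ne_zero j
  have hk' : (Nat.fib (k + 1) : ℝ) ≠ 0 := Nat.cast_ne_zero.2 (Nat.fib_pos.2 k.succ_pos).ne'
  have hj' : (Nat.fib (j + 1) : ℝ) ≠ 0 := Nat.cast_ne_zero.2 (Nat.fib_pos.2 j.succ_pos).ne'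
  have h := fib_add_eq_goldenRatio_pow_mul_fib (k + 1) (j + 1)
  rw [show k + 1 + (j + 1) = k + j + 1 + 1 by ring] at h
  rw [fibFact_succ (k + j + 1), fibFact_succ k, fibFact_succ j, h]
  field_simp

theorem neg_one_pow_triangle_succ (k : ℕ) :
    (-1 : ℝ) ^ ((k + 1) * (k + 1 - 1) / 2) =
      (Real.goldenRatio * Real.goldenConj) ^ k * (-1) ^ (k * (k - 1) / 2) := by
  rw [Nat.triangle_succ, pow_add, Real.goldenRatio_mul_goldenConj, mul_comm]

theorem neg_one_pow_mul_φ_zpow {n k : ℕ} (hk : k < n) :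
    (-1 : ℝ) ^ k * φ ^ ((n : ℤ) - 1 - 2 * k) =
      Real.goldenRatio ^ (n - 1 - k) * Real.goldenConj ^ k := by
  obtain ⟨j, rfl⟩ := Nat.exists_eq_add_of_lt hk
  have hφ := Real.goldenRatio_ne_zero
  have hψ : Real.goldenConj = -Real.goldenRatio⁻¹ := by rw [Real.inv_goldenRatio, neg_neg]
  rw [φ_eq_goldenRatio, show ((k + j + 1 : ℕ) : ℤ) - 1 - 2 * k = (j : ℤ) - k by push_cast; ring,
    show k + j + 1 - 1 - k = j by omega, zpow_sub₀ hφ, zpow_natCast, zpow_natCast, hψ,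
    neg_pow Real.goldenRatio⁻¹, inv_pow]
  ring

theorem prod_goldenRatio_goldenConj_succ (x y : ℝ) (n : ℕ) :
    ∏ k ∈ Finset.range (n + 1),
        (x + Real.goldenRatio ^ (n + 1 - 1 - k) * Real.goldenConj ^ k * y) =
      (∏ k ∈ Finset.range n,
        (x + Real.goldenRatio ^ (n - 1 - k) * Real.goldenConj ^ k * (Real.goldenRatio * y))) *
        (x + Real.goldenConj ^ n * y) := by
  rw [Finset.prod_range_succ]
  congr 1
  · refine Finset.prod_congr rfl fun k hk => ?_
    have hk := Finset.mem_range.1 hk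
    rw [show n + 1 - 1 - k = n - 1 - k + 1 by omega]
    ring
  · simp

theorem prod_goldenRatio_goldenConj_eq_sum (x y : ℝ) (n : ℕ) :
    ∏ k ∈ Finset.range n, (x + Real.goldenRatio ^ (n - 1 - k) * Real.goldenConj ^ k * y) =
      ∑ k ∈ Finset.range (n + 1),
        (fibFact n / (fibFact k * fibFact (n - k))) * (-1 : ℝ) ^ (k * (k - 1) / 2) *
          x ^ (n - k) * y ^ k := by
  induction n generalizing y with
  | zero => simp [fibFact]
  | succ n ih =>
    rw [prod_goldenRatio_goldenConj_succ, ih, mul_add, Finset.sum_mul, Finset.sum_mul,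
      Finset.sum_range_succ', Finset.sum_range_succ _ n, Finset.sum_range_succ' _ (n + 1),
      Finset.sum_range_succ _ n, add_add_add_comm, ← Finset.sum_add_distrib, add_assoc,
      add_comm (_ * x)]
    have h0 : fibFact 0 = 1 := rfl
    have hn := fibFact_ne_zero n
    have hn' := fibFact_ne_zero (n + 1)
    congr 1
    · refine Finset.sum_congr rfl fun k hk => ?_
      obtain ⟨j, rfl⟩ := Nat.exists_eq_add_of_lt (Finset.mem_range.1 hk)
      rw [neg_one_pow_triangle_succ, show k + j + 1 + 1 - (k + 1) = j + 1 by omega,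
        show k + j + 1 - (k + 1) = j by omega, show k + j + 1 - k = j + 1 by omega,
        fibonomial_succ_succ]
      generalize Real.goldenRatio = a, Real.goldenConj = b
      ring
    · congr 1
      · rw [neg_one_pow_triangle_succ]
        simp only [Nat.sub_self, h0, mul_one, div_self hn, div_self hn']
        generalize Real.goldenRatio = a, Real.goldenConj = b
        ring
      · simp only [Nat.sub_zero, h0, one_mul, div_self hn, div_self hn']
        ring

theorem golden_binomial_expansion (x y : ℝ) (n : ℕ) :
    (∏ k ∈ Finset.range n, (x + (-1 : ℝ) ^ k * φ ^ ((n : ℤ) - 1 - 2 * k) * y)) =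
      ∑ k ∈ Finset.range (n + 1),
        (fibFact n / (fibFact k * fibFact (n - k))) * (-1 : ℝ) ^ (k * (k - 1) / 2) *
          x ^ (n - k) * y ^ k := by
  rw [← prod_goldenRatio_goldenConj_eq_sum]
  refine Finset.prod_congr rfl fun k hk => ?_
  rw [neg_one_pow_mul_φ_zpow (Finset.mem_range.1 hk)]
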